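/- Universality of the band-limited product (main theorem): let φ be a flow on a compact metric space X. Then there exists a map F : X → (ℕ × ℕ → C(ℝ, ℝ)), where the target carries the product of compact-open topologies, such that: (1) F is a homeomorphism onto its image; (2) F is equivariant, i.e., F(φ(r, x))(n, i) = τ_r(F(x)(n, i)) for all r ∈ ℝ, x ∈ X, and n, i ∈ ℕ; (3) each component satisfies |F(x)(n, i)(t)| ≤ 1 for all t ∈ ℝ; and (4) each component F(x)(n, i) has distributional Fourier support contained in [-(n+1), n+1], i.e., for every Schwartz function g : ℝ → ℂ with support disjoint from [-(n+1), n+1], ∫_ℝ F(x)(n, i)(t) · (𝓕g)(t) dt = 0, where 𝓕g(ξ) = ∫_ℝ e^{-2πi t ξ} g(t) dt. -/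

import Mathlib

open MeasureTheory Real Topology

/-- The shift `τ_r` on the space `C(ℝ, E)` of continuous maps (compact-open topology):
`(τ_r f)(t) = f (t + r)`. -/
noncomputable def tau {E : Type*} [TopologicalSpace E] (r : ℝ) (f : C(ℝ, E)) : C(ℝ, E) :=
  f.comp ⟨fun t => t + r, continuous_add_right r⟩

/-- The Fourier transform `𝓕g(ξ) = ∫_ℝ e^{-2πitξ} g(t) dt`. -/
noncomputable def ftransform (g : ℝ → ℂ) (ξ : ℝ) : ℂ :=
  ∫ t : ℝ, Complex.exp ((-2) * Real.pi * Complex.I * t * ξ) * g t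

open scoped FourierTransform ContDiff

/-- A Schwartz function that is real-valued, has integral one, and whose Fourier transform
vanishes outside `[-1, 1]`. -/
lemma exists_real_band_limited_kernel :
    ∃ (k : ℝ → ℝ) (κ : SchwartzMap ℝ ℂ), (∀ s, ((k s : ℝ) : ℂ) = κ s) ∧ ∫ s, k s = 1 ∧
      ∀ v ∉ Set.Icc (-1 : ℝ) 1, 𝓕 (κ : ℝ → ℂ) v = 0 := by
  let b : ContDiffBump (0 : ℝ) := ⟨1 / 2, 1, by norm_num, by norm_num⟩
  have hb : HasCompactSupport (fun x => ((b x : ℝ) : ℂ)) :=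
    b.hasCompactSupport.comp_left (g := fun x : ℝ => (x : ℂ)) (by simp)
  have hb' : ContDiff ℝ ∞ (fun x => ((b x : ℝ) : ℂ)) :=
    Complex.ofRealCLM.contDiff.comp b.contDiff
  let χ : SchwartzMap ℝ ℂ := hb.toSchwartzMap hb'
  have hχ (x : ℝ) : χ x = ((b x : ℝ) : ℂ) := rfl
  have hFκ : 𝓕 ((𝓕⁻ χ : SchwartzMap ℝ ℂ) : ℝ → ℂ) = χ := by
    rw [← SchwartzMap.fourier_coe, FourierTransform.fourier_fourierInv_eq]
  have hreal (s : ℝ) : (((𝓕⁻ χ : SchwartzMap ℝ ℂ) s).re : ℂ) = (𝓕⁻ χ : SchwartzMap ℝ ℂ) s := by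
    rw [← Complex.conj_eq_iff_re, SchwartzMap.fourierInv_coe]
    have h1 : 𝓕⁻ (χ : ℝ → ℂ) s = 𝓕 (χ : ℝ → ℂ) s := by
      rw [Real.fourierInv_eq_fourier_comp_neg]
      have h2 : (fun x => χ (-x)) = χ := by
        ext x
        rw [hχ, hχ, b.neg]
      rw [h2]
    conv_rhs => rw [h1]
    rw [Real.fourierInv_eq', Real.fourier_eq', ← integral_conj]
    refine integral_congr_ae (.of_forall fun v => ?_)
    simp [hχ, ← Complex.exp_conj, Complex.conj_ofNat]
  refine ⟨fun s => ((𝓕⁻ χ : SchwartzMap ℝ ℂ) s).re, 𝓕⁻ χ, hreal, ?_, ?_⟩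
  · have h := congrFun hFκ 0
    rw [Real.fourier_real_eq_integral_exp_smul] at h
    simp only [mul_zero, Complex.ofReal_zero, zero_mul, Complex.exp_zero, one_smul] at h
    have h2 : χ 0 = 1 := by
      rw [hχ, b.one_of_mem_closedBall (Metric.mem_closedBall_self b.rIn_pos.le),
        Complex.ofReal_one]
    rw [h2] at h
    have h3 : ∫ s, (((𝓕⁻ χ : SchwartzMap ℝ ℂ) s).re : ℂ) = 1 := by simpa only [hreal] using h
    rw [integral_complex_ofReal] at h3
    exact_mod_cast h3
  · intro v hv
    rw [hFκ, hχ, b.zero_of_le_dist]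
    · simp
    · rw [dist_zero_right, Real.norm_eq_abs]
      by_contra! h
      exact hv (abs_le.1 h.le)

lemma ftransform_eq_fourier (g : ℝ → ℂ) : ftransform g = 𝓕 g := by
  ext ξ
  rw [Real.fourier_real_eq_integral_exp_smul]
  simp only [ftransform, smul_eq_mul]
  refine integral_congr_ae (.of_forall fun t => ?_)
  beta_reduce
  congr 2
  push_cast
  ring

/-- A Fourier transform dilated by `R` and translated is, up to the factor `R`, the Fourier
transform of a dilated and modulated function. -/
lemma fourier_comp_add_div (g : ℝ → ℂ) {R : ℝ} (hR : 0 < R) (u s : ℝ) :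
    𝓕 g (u + s / R) =
      R * 𝓕 (fun w : ℝ => Complex.exp (↑(-2 * π * R * w * u) * Complex.I) * g (R * w)) s := by
  simp only [Real.fourier_real_eq_integral_exp_smul, smul_eq_mul]
  have h := Measure.integral_comp_mul_left
    (fun v : ℝ => Complex.exp (↑(-2 * π * v * (u + s / R)) * Complex.I) * g v) R
  have hR' : (R : ℂ) ≠ 0 := by exact_mod_cast hR.ne'
  rw [abs_of_pos (inv_pos.2 hR)] at h
  rw [← mul_right_inj' (inv_ne_zero hR'), inv_mul_cancel_left₀ hR']
  rw [Complex.real_smul, Complex.ofReal_inv] at h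
  rw [← h]
  refine integral_congr_ae (.of_forall fun w => ?_)
  beta_reduce
  rw [← mul_assoc (Complex.exp _) (Complex.exp _), ← Complex.exp_add]
  congr 2
  push_cast
  field_simp
  ring

lemma integral_kernel_mul_fourier_eq_zero (κ : SchwartzMap ℝ ℂ)
    (hκ : ∀ v ∉ Set.Icc (-1 : ℝ) 1, 𝓕 (κ : ℝ → ℂ) v = 0) {R : ℝ} (hR : 0 < R)
    (g : SchwartzMap ℝ ℂ) (hg : ∀ ξ ∈ Set.Icc (-R) R, g ξ = 0) (u : ℝ) :
    ∫ s : ℝ, κ s * 𝓕 (g : ℝ → ℂ) (u + s / R) = 0 := by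
  simp_rw [fourier_comp_add_div (g : ℝ → ℂ) hR, mul_left_comm _ (R : ℂ)]
  rw [integral_const_mul]
  set h : ℝ → ℂ := fun w : ℝ => Complex.exp (↑(-2 * π * R * w * u) * Complex.I) * g (R * w)
    with hh
  have hint : Integrable h := by
    refine (g.integrable.comp_mul_left' hR.ne').bdd_mul (c := 1) ?_ ?_
    · exact Continuous.aestronglyMeasurable (by fun_prop)
    · exact .of_forall fun x => (Complex.norm_exp_ofReal_mul_I _).le
  have key : ∫ s, 𝓕 (κ : ℝ → ℂ) s * h s = ∫ s, κ s * 𝓕 h s := by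
    simpa using! VectorFourier.integral_fourierIntegral_smul_eq_flip (L := innerₗ ℝ)
      (μ := volume) (ν := volume) Real.continuous_fourierChar continuous_inner κ.integrable hint
  rw [← key, integral_eq_zero_of_ae, mul_zero]
  refine .of_forall fun v => ?_
  by_cases hv : v ∈ Set.Icc (-1 : ℝ) 1
  · have : g (R * v) = 0 := hg _ ⟨by nlinarith [hv.1], by nlinarith [hv.2]⟩
    simp [hh, this]
  · simp [hκ v hv]

/-- If `k` annihilates all translates of `G`, then so does the convolution of `k` with any
bounded continuous function. -/
lemma integral_convolution_mul_eq_zero {k : ℝ → ℝ} (hk : Integrable k) (hkc : Continuous k)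
    {H : ℝ → ℝ} (hH : Continuous H) {C : ℝ} (hHC : ∀ t, |H t| ≤ C)
    {G : ℝ → ℂ} (hG : Integrable G) (hGc : Continuous G) (R : ℝ)
    (horth : ∀ u, ∫ s : ℝ, (k s : ℂ) * G (u + s / R) = 0) :
    ∫ t : ℝ, ((∫ s : ℝ, k s * H (t - s / R) : ℝ) : ℂ) * G t = 0 := by
  have hC (t : ℝ) : ‖(H t : ℂ)‖ ≤ C := by simpa using hHC t
  have hkC : Integrable (fun s => (k s : ℂ)) := hk.ofReal
  have i1 : Integrable (Function.uncurry fun t s : ℝ => (H (t - s / R) : ℂ) * (G t * k s))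
      (volume.prod volume) := by
    refine (hG.mul_prod hkC).bdd_mul (c := C) ?_ (.of_forall fun p => hC _)
    exact Continuous.aestronglyMeasurable (by fun_prop)
  have i2 : Integrable (Function.uncurry fun s u : ℝ => (H u : ℂ) * (k s * G (u + s / R)))
      (volume.prod volume) := by
    refine Integrable.bdd_mul (c := C) ?_ ?_ (.of_forall fun p => hC _)
    · rw [integrable_prod_iff (Continuous.aestronglyMeasurable (by fun_prop))]
      refine ⟨.of_forall fun s => (hG.comp_add_right (s / R)).const_mul (k s : ℂ), ?_⟩
      simp only [norm_mul, integral_const_mul]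
      refine (hkC.norm.mul_const (∫ u, ‖G u‖)).congr (.of_forall fun s => ?_)
      simp only
      rw [integral_add_right_eq_self (fun u => ‖G u‖)]
    · exact Continuous.aestronglyMeasurable (by fun_prop)
  calc ∫ t : ℝ, ((∫ s : ℝ, k s * H (t - s / R) : ℝ) : ℂ) * G t
      = ∫ t : ℝ, ∫ s : ℝ, (H (t - s / R) : ℂ) * (G t * k s) := by
        refine integral_congr_ae (.of_forall fun t => ?_)
        beta_reduce
        rw [← integral_complex_ofReal, ← integral_mul_const]
        refine integral_congr_ae (.of_forall fun s => ?_)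
        beta_reduce
        push_cast
        ring
    _ = ∫ s : ℝ, ∫ t : ℝ, (H (t - s / R) : ℂ) * (G t * k s) := integral_integral_swap i1
    _ = ∫ s : ℝ, ∫ u : ℝ, (H u : ℂ) * (k s * G (u + s / R)) := by
        refine integral_congr_ae (.of_forall fun s => ?_)
        beta_reduce
        rw [← integral_add_right_eq_self _ (s / R)]
        refine integral_congr_ae (.of_forall fun u => ?_)
        beta_reduce
        rw [add_sub_cancel_right]
        ring
    _ = ∫ u : ℝ, ∫ s : ℝ, (H u : ℂ) * (k s * G (u + s / R)) := integral_integral_swap i2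
    _ = 0 := by simp [integral_const_mul, horth]

lemma exists_countable_separating_bounded (X : Type*) [MetricSpace X] [CompactSpace X] {C : ℝ}
    (hC : 0 < C) :
    ∃ f : ℕ → X → ℝ, (∀ i, Continuous (f i)) ∧ (∀ i x, |f i x| ≤ C) ∧
      ∀ x y, (∀ i, f i x = f i y) → x = y := by
  cases isEmpty_or_nonempty X
  · exact ⟨fun _ _ => 0, fun _ => continuous_const, by simp [hC.le], fun x => isEmptyElim x⟩
  refine ⟨fun i x => min (dist x (TopologicalSpace.denseSeq X i)) C, fun i => by fun_prop,
    fun i x => ?_, fun x y h => ?_⟩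
  · rw [abs_of_nonneg (le_min dist_nonneg hC.le)]
    exact min_le_right _ _
  · refine eq_of_forall_dist_le fun ε hε => ?_
    obtain ⟨i, hi⟩ := (TopologicalSpace.denseRange_denseSeq X).exists_dist_lt x
      (lt_min (half_pos hε) hC)
    have hx := lt_min_iff.1 hi
    have h' : min _ C = min _ C := h i
    rw [min_eq_left hx.2.le] at h'
    have hy : dist y (TopologicalSpace.denseSeq X i) =
        dist x (TopologicalSpace.denseSeq X i) := by
      rcases min_choice (dist y (TopologicalSpace.denseSeq X i)) C with h1 | h1 <;> linarith
    linarith [dist_triangle_right x y (TopologicalSpace.denseSeq X i)]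

/-- Averaging `f` along the orbits of `φ` against the kernel `k` dilated by `1 / R`. -/
noncomputable def orbitAverage {X : Type*} (φ : ℝ × X → X) (k : ℝ → ℝ) (f : X → ℝ) (R : ℝ)
    (x : X) (t : ℝ) : ℝ :=
  ∫ s : ℝ, k s * f (φ (t - s / R, x))

lemma continuous_orbitAverage {X : Type*} [TopologicalSpace X] [FirstCountableTopology X]
    {φ : ℝ × X → X} (hφ : Continuous φ) {k : ℝ → ℝ} (hk : Integrable k) (hkc : Continuous k)
    {f : X → ℝ} (hf : Continuous f) {C : ℝ} (hfC : ∀ x, |f x| ≤ C) (R : ℝ) :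
    Continuous fun p : X × ℝ => orbitAverage φ k f R p.1 p.2 := by
  refine continuous_of_dominated (bound := fun s => |k s| * C) (fun p => ?_) (fun p => ?_)
    (hk.abs.mul_const C) (.of_forall fun s => ?_)
  · exact Continuous.aestronglyMeasurable (by fun_prop)
  · refine .of_forall fun s => ?_
    rw [Real.norm_eq_abs, abs_mul]
    exact mul_le_mul_of_nonneg_left (hfC _) (abs_nonneg _)
  · fun_prop

lemma abs_orbitAverage_le {X : Type*} (φ : ℝ × X → X) {k : ℝ → ℝ} (hk : Integrable k)
    {f : X → ℝ} {C : ℝ} (hfC : ∀ x, |f x| ≤ C) (R : ℝ) (x : X) (t : ℝ) :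
    |orbitAverage φ k f R x t| ≤ (∫ s, |k s|) * C := by
  rw [← integral_mul_const, ← Real.norm_eq_abs]
  refine norm_integral_le_of_norm_le (hk.abs.mul_const C) (.of_forall fun s => ?_)
  rw [Real.norm_eq_abs, abs_mul]
  exact mul_le_mul_of_nonneg_left (hfC _) (abs_nonneg _)

lemma tendsto_orbitAverage {X : Type*} [TopologicalSpace X]
    {φ : ℝ × X → X} (hφ : Continuous φ) (h0 : ∀ x, φ (0, x) = x)
    {k : ℝ → ℝ} (hk : Integrable k) (hkc : Continuous k) (hk1 : ∫ s, k s = 1)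
    {f : X → ℝ} (hf : Continuous f) {C : ℝ} (hfC : ∀ x, |f x| ≤ C) (x : X) :
    Filter.Tendsto (fun n : ℕ => orbitAverage φ k f (n + 1) x 0) Filter.atTop (𝓝 (f x)) := by
  have hlim : ∫ s, k s * f x = f x := by rw [integral_mul_const, hk1, one_mul]
  rw [← hlim]
  refine tendsto_integral_of_dominated_convergence (fun s => |k s| * C) (fun n => ?_)
    (hk.abs.mul_const C) (fun n => .of_forall fun s => ?_) (.of_forall fun s => ?_)
  · exact Continuous.aestronglyMeasurable (by fun_prop)
  · rw [Real.norm_eq_abs, abs_mul]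
    exact mul_le_mul_of_nonneg_left (hfC _) (abs_nonneg _)
  · have h1 : Filter.Tendsto (fun n : ℕ => 0 - s / ((n : ℝ) + 1)) Filter.atTop (𝓝 0) := by
      simpa [div_eq_mul_inv] using
        (tendsto_one_div_add_atTop_nhds_zero_nat (𝕜 := ℝ)).const_mul (-s)
    have h2 : Continuous fun t : ℝ => k s * f (φ (t, x)) := by fun_prop
    simpa [h0, Function.comp_def] using (h2.tendsto 0).comp h1

/-- Universality of the band-limited product (main theorem): every flow `φ` on a compact
metric space `X` embeds equivariantly into the countable product of band-limited balls:
there is `F : X → (ℕ × ℕ → C(ℝ, ℝ))` (product of compact-open topologies) which is a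
homeomorphism onto its image, equivariant for the shifts, with all components bounded
by `1` and with distributional Fourier support of `F x (n, i)` contained in
`[-(n+1), n+1]`. -/
theorem universal_band_limited_product {X : Type*} [MetricSpace X] [CompactSpace X]
    (φ : ℝ × X → X) (hφ : Continuous φ)
    (h0 : ∀ x, φ (0, x) = x)
    (hadd : ∀ (s t : ℝ) (x : X), φ (s + t, x) = φ (s, φ (t, x))) :
    ∃ F : X → (ℕ × ℕ → C(ℝ, ℝ)),
      IsEmbedding F ∧
      (∀ (r : ℝ) (x : X) (n i : ℕ), F (φ (r, x)) (n, i) = tau r (F x (n, i))) ∧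
      (∀ (x : X) (n i : ℕ) (t : ℝ), |F x (n, i) t| ≤ 1) ∧
      (∀ (x : X) (n i : ℕ) (g : SchwartzMap ℝ ℂ),
        (∀ ξ ∈ Set.Icc (-(n + 1 : ℝ)) (n + 1 : ℝ), g ξ = 0) →
        ∫ t : ℝ, ((F x (n, i) t : ℝ) : ℂ) * ftransform g t = 0) := by
  obtain ⟨k, κ, hκ, hk1, hsupp⟩ := exists_real_band_limited_kernel
  have hkre : k = fun s => (κ s).re := by
    ext s
    rw [← hκ, Complex.ofReal_re]
  have hk : Integrable k := hkre ▸ κ.integrable.re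
  have hkc : Continuous k := hkre ▸ Complex.continuous_re.comp κ.continuous
  have hL : 0 < ∫ s, |k s| := by
    have h := abs_integral_le_integral_abs (f := k) (μ := volume)
    rw [hk1, abs_one] at h
    linarith
  obtain ⟨f, hf, hfC, hsep⟩ := exists_countable_separating_bounded X (inv_pos.2 hL)
  have hcont (n i : ℕ) := continuous_orbitAverage hφ hk hkc (hf i) (hfC i) (n + 1)
  let F : X → (ℕ × ℕ → C(ℝ, ℝ)) := fun x p =>
    ⟨orbitAverage φ k (f p.2) (p.1 + 1) x,
      (hcont p.1 p.2).comp (Continuous.prodMk_right x)⟩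
  have hF (x : X) (n i : ℕ) (t : ℝ) : F x (n, i) t = orbitAverage φ k (f i) (n + 1) x t := rfl
  refine ⟨F, ?_, fun r x n i => ?_, fun x n i t => ?_, fun x n i g hg => ?_⟩
  · refine (Continuous.isClosedEmbedding ?_ ?_).isEmbedding
    · exact continuous_pi fun p => ContinuousMap.continuous_of_continuous_uncurry _ (hcont p.1 p.2)
    · intro x y hxy
      refine hsep x y fun i => ?_
      refine tendsto_nhds_unique (tendsto_orbitAverage hφ h0 hk hkc hk1 (hf i) (hfC i) x) ?_
      refine (tendsto_orbitAverage hφ h0 hk hkc hk1 (hf i) (hfC i) y).congr fun n => ?_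
      rw [← hF, ← hF, hxy]
  · ext t
    change orbitAverage φ k (f i) (n + 1) (φ (r, x)) t =
      orbitAverage φ k (f i) (n + 1) x (t + r)
    unfold orbitAverage
    congr 1
    ext s
    rw [← hadd, sub_add_eq_add_sub]
  · rw [hF]
    exact (abs_orbitAverage_le φ hk (hfC i) _ x t).trans_eq (mul_inv_cancel₀ hL.ne')
  · rw [ftransform_eq_fourier]
    refine integral_convolution_mul_eq_zero hk hkc (H := fun u => f i (φ (u, x))) ?_
      (fun t => hfC i _) (G := 𝓕 (g : ℝ → ℂ)) ?_ ?_ (n + 1) fun u => ?_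
    · exact (hf i).comp (hφ.comp (Continuous.prodMk_left x))
    · exact (𝓕 g : SchwartzMap ℝ ℂ).integrable
    · exact (𝓕 g : SchwartzMap ℝ ℂ).continuous
    · simp_rw [hκ]
      exact integral_kernel_mul_fourier_eq_zero κ hsupp (by positivity) g hg u
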